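/- arXiv:1508.03735 — 6 statements merged into one kernel-verified Lean document; each statement's English description precedes it below -/
import Mathlib

section
/- There exist absolute constants c > 0 and C ≥ 0 such that for every n ≥ 1, every real ρ ≥ 1, and every coordination protocol for one-to-one matching on n players that achieves approximation ratio ρ, the message space satisfies Real.log N ≥ c·n/ρ⁴ − C. In particular, any protocol guaranteeing a ρ-approximation in expectation must broadcast Ω(n/ρ⁴) bits. -/
open Finset in
/-- For a random permutation, a player seeing the image of `insert i R` guesses the image of `i`
with probability at most `1 / (|R| + 1)`. -/
lemma perm_guess {α β : Type*} [Fintype α] [DecidableEq α] [DecidableEq β]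
    (R : Finset α) (e : α → β) (he : Function.Injective e) (g : Finset α → β) (i : α)
    (hi : i ∉ R) :
    (#{τ : Equiv.Perm α | g ((insert i R).image τ) = e (τ i)}) * (#R + 1)
      ≤ Fintype.card (Equiv.Perm α) := by
  classical
  have h1 : ∀ r ∈ insert i R,
      #{τ : Equiv.Perm α | g ((insert i R).image τ) = e (τ r)}
        = #{τ : Equiv.Perm α | g ((insert i R).image τ) = e (τ i)} := by
    intro r hr
    have himg : ∀ τ : Equiv.Perm α,
        (insert i R).image (τ * Equiv.swap i r) = (insert i R).image τ := by
      intro τ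
      have : (insert i R).image (Equiv.swap i r) = insert i R := by
        apply Finset.eq_of_subset_of_card_le
        · intro x hx
          obtain ⟨y, hy, rfl⟩ := Finset.mem_image.1 hx
          rcases Equiv.swap_apply_eq_iff.1 (rfl : Equiv.swap i r y = _) with _
          by_cases h1 : y = i
          · subst h1; simpa using hr
          · by_cases h2 : y = r
            · subst h2; simp
            · rwa [Equiv.swap_apply_of_ne_of_ne h1 h2]
        · rw [Finset.card_image_of_injective _ (Equiv.injective _)]
      conv_rhs => rw [← this]
      rw [Finset.image_image]
      rfl
    refine Finset.card_bij (fun τ _ => τ * Equiv.swap i r) ?_ ?_ ?_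
    · intro τ hτ
      simp only [Finset.mem_filter, Finset.mem_univ, true_and] at hτ ⊢
      rw [himg, hτ]; simp
    · intro a _ b _ h
      exact mul_right_cancel h
    · intro τ hτ
      refine ⟨τ * Equiv.swap i r, ?_, ?_⟩
      · simp only [Finset.mem_filter, Finset.mem_univ, true_and] at hτ ⊢
        rw [himg, hτ]; simp
      · simp [mul_assoc]
  have h2 : ∑ r ∈ insert i R, #{τ : Equiv.Perm α | g ((insert i R).image τ) = e (τ r)}
      ≤ Fintype.card (Equiv.Perm α) := by
    rw [← Finset.card_biUnion]
    · exact Finset.card_le_univ _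
    · intro a _ b _ hab
      rw [Function.onFun, Finset.disjoint_left]
      intro τ h1 h2
      simp only [Finset.mem_filter, Finset.mem_univ, true_and] at h1 h2
      exact hab (τ.injective (he (h1.symm.trans h2)))
  rw [Finset.sum_congr rfl h1, Finset.sum_const, Finset.card_insert_of_notMem hi, smul_eq_mul] at h2
  linarith

open Finset in
/-- Welfare collected inside one block. -/
def blockW {α β : Type*} [Fintype α] [DecidableEq α] [DecidableEq β]
    (R : Finset α) (e : α → β) (g : α → Finset α → β) (τ : Equiv.Perm α) : ℕ :=
  #{j : α | ∃ i, g i ((insert i R).image τ) = e j ∧ j ∈ (insert i R).image τ}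

open Finset in
lemma blockW_sum {α β : Type*} [Fintype α] [DecidableEq α] [DecidableEq β]
    (R : Finset α) (e : α → β) (he : Function.Injective e) (g : α → Finset α → β) :
    (∑ τ, blockW R e g τ) * (#R + 1)
      ≤ Fintype.card (Equiv.Perm α) * (#R * (#R + 1) + Fintype.card α) := by
  classical
  have h1 : ∀ τ, blockW R e g τ
      ≤ #R + ∑ i ∈ Rᶜ, if g i ((insert i R).image τ) = e (τ i) then 1 else 0 := by
    intro τ
    rw [← Finset.card_filter]
    have : ({j : α | ∃ i, g i ((insert i R).image τ) = e j ∧ j ∈ (insert i R).image τ} : Finset α)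
        ⊆ R.image τ ∪ ({i ∈ Rᶜ | g i ((insert i R).image τ) = e (τ i)} : Finset α).image τ := by
      intro j hj
      simp only [Finset.mem_filter, Finset.mem_univ, true_and] at hj
      obtain ⟨i, hg, hj⟩ := hj
      rw [Finset.mem_union]
      by_cases hjR : j ∈ R.image τ
      · exact Or.inl hjR
      · right
        have hji : j = τ i := by
          rw [Finset.image_insert, Finset.mem_insert] at hj
          tauto
        subst hji
        refine Finset.mem_image_of_mem _ ?_
        rw [Finset.mem_filter]
        refine ⟨?_, hg⟩
        rw [Finset.mem_compl]
        exact fun h => hjR (Finset.mem_image_of_mem _ h)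
    calc blockW R e g τ ≤ _ := Finset.card_le_card this
      _ ≤ _ := Finset.card_union_le _ _
      _ ≤ _ := add_le_add Finset.card_image_le Finset.card_image_le
  calc (∑ τ, blockW R e g τ) * (#R + 1)
      ≤ (∑ τ : Equiv.Perm α, (#R + ∑ i ∈ Rᶜ,
          if g i ((insert i R).image τ) = e (τ i) then 1 else 0)) * (#R + 1) :=
        Nat.mul_le_mul_right _ (Finset.sum_le_sum fun τ _ => h1 τ)
    _ = Fintype.card (Equiv.Perm α) * (#R * (#R + 1)) + ∑ i ∈ Rᶜ,
          #{τ : Equiv.Perm α | g i ((insert i R).image τ) = e (τ i)} * (#R + 1) := by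
        rw [Finset.sum_add_distrib, Finset.sum_comm, add_mul, ← Finset.sum_mul]
        simp only [Finset.sum_const, Finset.card_univ, smul_eq_mul, Finset.card_filter]
        ring
    _ ≤ Fintype.card (Equiv.Perm α) * (#R * (#R + 1)) + ∑ i ∈ Rᶜ,
          Fintype.card (Equiv.Perm α) := by
        gcongr with i hi
        exact perm_guess R e he (g i) i (Finset.mem_compl.1 hi)
    _ ≤ Fintype.card (Equiv.Perm α) * (#R * (#R + 1)) + ∑ i : α,
          Fintype.card (Equiv.Perm α) := by
        gcongr
        exact Finset.subset_univ _
    _ = _ := by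
        simp only [Finset.sum_const, Finset.card_univ, smul_eq_mul]
        ring

/-- Moment generating function of the block welfare. -/
lemma blockW_mgf {β : Type*} [DecidableEq β] (k : ℕ) (hk : 1 ≤ k)
    (R : Finset (Fin (k ^ 2))) (hR : R.card = k - 1)
    (e : Fin (k ^ 2) → β) (he : Function.Injective e)
    (g : Fin (k ^ 2) → Finset (Fin (k ^ 2)) → β) :
    ∑ τ, Real.exp ((blockW R e g τ : ℝ) / (k : ℝ) ^ 2)
      ≤ (Fintype.card (Equiv.Perm (Fin (k ^ 2))) : ℝ) * Real.exp (4 / (k : ℝ)) := by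
  have hk0 : (0 : ℝ) < k := by exact_mod_cast hk
  have hsum := blockW_sum R e he g
  rw [hR, Nat.sub_add_cancel hk, Fintype.card_fin] at hsum
  set M := Fintype.card (Equiv.Perm (Fin (k ^ 2))) with hM
  have hs2 : (∑ τ, (blockW R e g τ : ℝ)) ≤ M * (2 * k) := by
    have h3 : (∑ τ, blockW R e g τ) * k ≤ (M * (2 * k)) * k := by
      refine hsum.trans ?_
      rw [mul_assoc]
      refine Nat.mul_le_mul_left _ ?_
      have : k - 1 ≤ k := Nat.sub_le _ _
      nlinarith
    have := Nat.le_of_mul_le_mul_right h3 hk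
    exact_mod_cast this
  have hpt : ∀ τ, Real.exp ((blockW R e g τ : ℝ) / (k : ℝ) ^ 2)
      ≤ 1 + 2 * ((blockW R e g τ : ℝ) / (k : ℝ) ^ 2) := by
    intro τ
    have hx0 : (0 : ℝ) ≤ (blockW R e g τ : ℝ) / (k : ℝ) ^ 2 := by positivity
    have hx1 : (blockW R e g τ : ℝ) / (k : ℝ) ^ 2 ≤ 1 := by
      rw [div_le_one (by positivity)]
      have : blockW R e g τ ≤ k ^ 2 := by
        refine (Finset.card_le_univ _).trans ?_
        simp
      exact_mod_cast this
    have := Real.abs_exp_sub_one_le (x := (blockW R e g τ : ℝ) / (k : ℝ) ^ 2)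
      (by rw [abs_of_nonneg hx0]; exact hx1)
    rw [abs_of_nonneg hx0] at this
    have := (abs_le.1 this).2
    linarith
  calc ∑ τ, Real.exp ((blockW R e g τ : ℝ) / (k : ℝ) ^ 2)
      ≤ ∑ τ, (1 + 2 * ((blockW R e g τ : ℝ) / (k : ℝ) ^ 2)) :=
        Finset.sum_le_sum fun τ _ => hpt τ
    _ = M + 2 / (k : ℝ) ^ 2 * ∑ τ, (blockW R e g τ : ℝ) := by
        rw [Finset.sum_add_distrib, Finset.mul_sum]
        congr 1
        · simp [hM]
        · exact Finset.sum_congr rfl fun τ _ => by ring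
    _ ≤ M + 2 / (k : ℝ) ^ 2 * (M * (2 * k)) := by gcongr
    _ = M * (4 / (k : ℝ) + 1) := by field_simp; ring
    _ ≤ _ := by gcongr; exact Real.add_one_le_exp _

/-- The hard instance. -/
def hardInst {n q G : ℕ} (e : Fin q × Fin G → Fin n) (R : Finset (Fin G))
    (τ : Fin q → Equiv.Perm (Fin G)) (p : Fin n) : Finset (Fin n) :=
  Finset.univ.filter fun j => ∃ b i x, e (b, i) = p ∧ e (b, x) = j ∧
    x ∈ (insert i R).image (τ b)

lemma hardInst_apply {n q G : ℕ} (e : Fin q × Fin G → Fin n) (he : Function.Injective e)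
    (R : Finset (Fin G)) (τ : Fin q → Equiv.Perm (Fin G)) (b : Fin q) (i : Fin G) :
    hardInst e R τ (e (b, i)) = ((insert i R).image (τ b)).image (fun x => e (b, x)) := by
  ext j
  simp only [hardInst, Finset.mem_filter, Finset.mem_univ, true_and]
  rw [Finset.mem_image]
  constructor
  · rintro ⟨b', i', x, h1, h2, h3⟩
    have := he h1
    simp only [Prod.mk.injEq] at this
    obtain ⟨rfl, rfl⟩ := this
    exact ⟨x, h3, h2⟩
  · rintro ⟨x, h3, h2⟩
    exact ⟨b, i, x, rfl, h2, h3⟩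

/-- Strategy restricted to a block. -/
def blockStrat {n q G : ℕ} (e : Fin q × Fin G → Fin n) (g : Fin n → Finset (Fin n) → Fin n)
    (b : Fin q) (i : Fin G) (B : Finset (Fin G)) : Fin n :=
  g (e (b, i)) (B.image (fun x => e (b, x)))

lemma welfare_le {n q G : ℕ} (e : Fin q × Fin G → Fin n) (he : Function.Injective e)
    (R : Finset (Fin G)) (τ : Fin q → Equiv.Perm (Fin G))
    (g : Fin n → Finset (Fin n) → Fin n) :
    (Finset.univ.filter (fun j : Fin n =>
      ∃ i : Fin n, g i (hardInst e R τ i) = j ∧ j ∈ hardInst e R τ i)).card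
      ≤ ∑ b, blockW R (fun x => e (b, x)) (blockStrat e g b) (τ b) := by
  classical
  have hsub : (Finset.univ.filter (fun j : Fin n =>
      ∃ i : Fin n, g i (hardInst e R τ i) = j ∧ j ∈ hardInst e R τ i)) ⊆
      Finset.univ.biUnion (fun b => (Finset.univ.filter (fun j : Fin G =>
        ∃ i, blockStrat e g b i ((insert i R).image (τ b)) = e (b, j) ∧
          j ∈ (insert i R).image (τ b))).image (fun x => e (b, x))) := by
    intro j hj
    simp only [Finset.mem_filter, Finset.mem_univ, true_and] at hj
    obtain ⟨p, hg, hj⟩ := hj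
    have hj' := hj
    rw [hardInst, Finset.mem_filter] at hj'
    obtain ⟨-, b, i, x, rfl, rfl, hx⟩ := hj'
    rw [Finset.mem_biUnion]
    refine ⟨b, Finset.mem_univ _, Finset.mem_image.2 ⟨x, ?_, rfl⟩⟩
    rw [Finset.mem_filter]
    refine ⟨Finset.mem_univ _, i, ?_, hx⟩
    rw [hardInst_apply e he] at hg
    exact hg
  refine (Finset.card_le_card hsub).trans (Finset.card_biUnion_le.trans ?_)
  refine Finset.sum_le_sum fun b _ => Finset.card_image_le.trans (le_of_eq ?_)
  unfold blockW
  congr!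

lemma total_mgf {n q k : ℕ} (hk : 1 ≤ k) (e : Fin q × Fin (k ^ 2) → Fin n)
    (he : Function.Injective e) (R : Finset (Fin (k ^ 2))) (hR : R.card = k - 1)
    (g : Fin n → Finset (Fin n) → Fin n) :
    ∑ τ : Fin q → Equiv.Perm (Fin (k ^ 2)), Real.exp (((Finset.univ.filter (fun j : Fin n =>
      ∃ i : Fin n, g i (hardInst e R τ i) = j ∧ j ∈ hardInst e R τ i)).card : ℝ) / (k : ℝ) ^ 2)
      ≤ (Fintype.card (Fin q → Equiv.Perm (Fin (k ^ 2))) : ℝ) * Real.exp (4 * q / (k : ℝ)) := by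
  classical
  calc _ ≤ ∑ τ : Fin q → Equiv.Perm (Fin (k ^ 2)), ∏ b, Real.exp
          ((blockW R (fun x => e (b, x)) (blockStrat e g b) (τ b) : ℝ) / (k : ℝ) ^ 2) := by
        refine Finset.sum_le_sum fun τ _ => ?_
        rw [← Real.exp_sum, ← Finset.sum_div]
        gcongr
        exact_mod_cast welfare_le e he R τ g
    _ = ∏ b : Fin q, ∑ t : Equiv.Perm (Fin (k ^ 2)), Real.exp
          ((blockW R (fun x => e (b, x)) (blockStrat e g b) t : ℝ) / (k : ℝ) ^ 2) := by
        rw [Finset.prod_univ_sum, Fintype.piFinset_univ]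
    _ ≤ ∏ b : Fin q, ((Fintype.card (Equiv.Perm (Fin (k ^ 2))) : ℝ) * Real.exp (4 / (k : ℝ))) := by
        refine Finset.prod_le_prod (fun b _ => by positivity) fun b _ => ?_
        refine blockW_mgf k hk R hR _ ?_ _
        intro x y h
        have := he h
        simpa using this
    _ = _ := by
        rw [Finset.prod_const, mul_pow, ← Real.exp_nat_mul]
        simp only [Finset.card_univ, Fintype.card_fin, Fintype.card_pi, Finset.prod_const,
          Nat.cast_pow]
        congr 2
        ring

/-- **Coordination complexity lower bound for one-to-one matchings.**
There are absolute constants `c > 0` and `C ≥ 0` such that for every `n ≥ 1`, every `ρ ≥ 1`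
and every coordination protocol (shared seed space `Fin S`, encoder `σ`, decoder `π`,
message space `Fin N`) for one-to-one matching on `n` players that achieves approximation
ratio `ρ` (for every instance `A` and every matching of size `m` in `A`, `m` is at most
`ρ` times the expected realized welfare), the message space satisfies
`Real.log N ≥ c·n/ρ⁴ − C`. -/
theorem one_to_one_matching_coordination_lower_bound :
    ∃ c C : ℝ, 0 < c ∧ 0 ≤ C ∧
      ∀ (n : ℕ), 1 ≤ n → ∀ (ρ : ℝ), 1 ≤ ρ →
      ∀ (N S : ℕ), 0 < N → 0 < S →
      ∀ (σ : Fin S → (Fin n → Finset (Fin n)) → Fin N)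
        (π : Fin S → Fin n → Finset (Fin n) → Fin N → Fin n),
      (∀ (A : Fin n → Finset (Fin n)) (m : ℕ),
        (∃ (I : Finset (Fin n)) (f : Fin n → Fin n),
          I.card = m ∧ Set.InjOn f ↑I ∧ ∀ i ∈ I, f i ∈ A i) →
        (m : ℝ) ≤ ρ * ((1 : ℝ) / (S : ℝ)) *
          ∑ s : Fin S,
            ((Finset.univ.filter (fun j : Fin n =>
              ∃ i : Fin n, π s i (A i) (σ s A) = j ∧ j ∈ A i)).card : ℝ)) →
      Real.log N ≥ c * (n : ℝ) / ρ ^ 4 - C := by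
  refine ⟨1 / 324, 1, by norm_num, by norm_num, ?_⟩
  intro n hn ρ hρ N S hN hS σ π h
  have hρ0 : 0 < ρ := by linarith
  obtain ⟨k, hk⟩ : ∃ k : ℕ, k = ⌈8 * ρ⌉₊ := ⟨_, rfl⟩
  have hk1 : 8 * ρ ≤ k := hk ▸ Nat.le_ceil _
  have hk2 : (k : ℝ) ≤ 9 * ρ := by
    have := Nat.ceil_lt_add_one (a := 8 * ρ) (by positivity)
    rw [← hk] at this
    linarith
  have hk0 : (0 : ℝ) < k := by linarith
  have hkpos : 1 ≤ k := by exact_mod_cast hk0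
  have hlogN : 0 ≤ Real.log N := Real.log_natCast_nonneg N
  have hksq : (k : ℝ) ^ 2 ≤ 81 * ρ ^ 2 := by nlinarith
  have hρ24 : ρ ^ 2 ≤ ρ ^ 4 := pow_le_pow_right₀ hρ (by norm_num)
  by_cases hsmall : n < k ^ 2
  · have h1 : (n : ℝ) < (k : ℝ) ^ 2 := by exact_mod_cast hsmall
    have h2 : 1 / 324 * (n : ℝ) / ρ ^ 4 ≤ 1 := by
      rw [div_le_one (by positivity)]
      linarith
    linarith
  push Not at hsmall
  obtain ⟨q, hq⟩ : ∃ q : ℕ, q = n / k ^ 2 := ⟨_, rfl⟩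
  have hksqpos : 0 < k ^ 2 := by positivity
  have hqn : q * k ^ 2 ≤ n := hq ▸ Nat.div_mul_le_self _ _
  have hq2 : n ≤ 2 * (q * k ^ 2) := by
    have h1 : n < (q + 1) * k ^ 2 := by
      rw [hq]; exact Nat.lt_mul_of_div_lt (Nat.lt_succ_self _) hksqpos
    have h2 : 1 ≤ q := by rw [hq]; exact Nat.div_pos hsmall hksqpos
    nlinarith
  obtain ⟨e, he⟩ : ∃ e : Fin q × Fin (k ^ 2) → Fin n, Function.Injective e :=
    ⟨fun x => Fin.castLE hqn (finProdFinEquiv x), fun x y hxy =>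
      finProdFinEquiv.injective (Fin.castLE_injective hqn hxy)⟩
  obtain ⟨R, -, hR⟩ : ∃ R ⊆ (Finset.univ : Finset (Fin (k ^ 2))), R.card = k - 1 := by
    apply Finset.exists_subset_card_eq
    rw [Finset.card_univ, Fintype.card_fin]
    have : k - 1 ≤ k := Nat.sub_le _ _
    nlinarith
  set M : ℝ := (Fintype.card (Fin q → Equiv.Perm (Fin (k ^ 2))) : ℝ) with hM
  have hM0 : 0 < M := by rw [hM]; exact_mod_cast Fintype.card_pos
  set L : ℝ := Real.log N + 4 * q / (k : ℝ) with hL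
  -- the welfare function
  set W : Fin S → (Fin n → Finset (Fin n)) → ℝ := fun s A =>
    ((Finset.univ.filter (fun j : Fin n =>
              ∃ i : Fin n, π s i (A i) (σ s A) = j ∧ j ∈ A i)).card : ℝ) with hW
  have hseed : ∀ s, ∑ τ : Fin q → Equiv.Perm (Fin (k ^ 2)), W s (hardInst e R τ)
      ≤ M * ((k : ℝ) ^ 2 * L) := by
    intro s
    have hexp : ∑ τ : Fin q → Equiv.Perm (Fin (k ^ 2)),
        Real.exp (W s (hardInst e R τ) / (k : ℝ) ^ 2) ≤ M * Real.exp L := by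
      calc _ ≤ ∑ τ : Fin q → Equiv.Perm (Fin (k ^ 2)), ∑ m : Fin N,
            Real.exp (((Finset.univ.filter (fun j : Fin n =>
              ∃ i : Fin n, π s i (hardInst e R τ i) m = j ∧ j ∈ hardInst e R τ i)).card : ℝ)
              / (k : ℝ) ^ 2) := by
            refine Finset.sum_le_sum fun τ _ => ?_
            exact Finset.single_le_sum (f := fun m : Fin N =>
              Real.exp (((Finset.univ.filter (fun j : Fin n =>
              ∃ i : Fin n, π s i (hardInst e R τ i) m = j ∧ j ∈ hardInst e R τ i)).card : ℝ)
              / (k : ℝ) ^ 2)) (fun m _ => (Real.exp_pos _).le)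
              (Finset.mem_univ (σ s (hardInst e R τ)))
        _ ≤ ∑ m : Fin N, M * Real.exp (4 * q / (k : ℝ)) := by
            rw [Finset.sum_comm]
            exact Finset.sum_le_sum fun m _ =>
              total_mgf hkpos e he R hR (fun i B => π s i B m)
        _ = M * Real.exp L := by
            rw [hL, Real.exp_add, Real.exp_log (by exact_mod_cast hN)]
            simp only [Finset.sum_const, Finset.card_univ, Fintype.card_fin, nsmul_eq_mul]
            ring
    have hpt : ∀ τ : Fin q → Equiv.Perm (Fin (k ^ 2)), W s (hardInst e R τ) / (k : ℝ) ^ 2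
        ≤ (L - 1) + Real.exp (-L) * Real.exp (W s (hardInst e R τ) / (k : ℝ) ^ 2) := by
      intro τ
      have := Real.add_one_le_exp (-L + W s (hardInst e R τ) / (k : ℝ) ^ 2)
      rw [Real.exp_add] at this
      linarith
    have h3 : (∑ τ : Fin q → Equiv.Perm (Fin (k ^ 2)), W s (hardInst e R τ)) / (k : ℝ) ^ 2
        ≤ M * L := by
      rw [Finset.sum_div]
      calc _ ≤ ∑ τ : Fin q → Equiv.Perm (Fin (k ^ 2)), ((L - 1) +
            Real.exp (-L) * Real.exp (W s (hardInst e R τ) / (k : ℝ) ^ 2)) :=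
            Finset.sum_le_sum fun τ _ => hpt τ
        _ = M * (L - 1) + Real.exp (-L) * ∑ τ : Fin q → Equiv.Perm (Fin (k ^ 2)),
            Real.exp (W s (hardInst e R τ) / (k : ℝ) ^ 2) := by
            rw [Finset.sum_add_distrib, Finset.mul_sum, Finset.sum_const, Finset.card_univ,
              nsmul_eq_mul]
        _ ≤ M * (L - 1) + Real.exp (-L) * (M * Real.exp L) := by gcongr
        _ = M * (L - 1) + M * (Real.exp (-L) * Real.exp L) := by ring
        _ = M * L := by
            rw [← Real.exp_add]; simp; ring
    rw [div_le_iff₀ (by positivity)] at h3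
    linarith
  have hmatch : ∀ τ : Fin q → Equiv.Perm (Fin (k ^ 2)),
      ((q * k ^ 2 : ℕ) : ℝ) ≤ ρ * ((1 : ℝ) / (S : ℝ)) * ∑ s, W s (hardInst e R τ) := by
    intro τ
    refine h (hardInst e R τ) (q * k ^ 2) ?_
    classical
    have hinv : ∀ x, Function.extend e (fun y : Fin q × Fin (k ^ 2) => e (y.1, τ y.1 y.2)) id (e x)
        = e (x.1, τ x.1 x.2) := fun x => he.extend_apply _ _ x
    refine ⟨Finset.univ.image e,
      Function.extend e (fun y : Fin q × Fin (k ^ 2) => e (y.1, τ y.1 y.2)) id, ?_, ?_, ?_⟩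
    · rw [Finset.card_image_of_injective _ he]; simp
    · intro a ha b hb hab
      simp only [Finset.coe_image, Finset.coe_univ, Set.image_univ, Set.mem_range] at ha hb
      obtain ⟨⟨x1, x2⟩, rfl⟩ := ha
      obtain ⟨⟨y1, y2⟩, rfl⟩ := hb
      rw [hinv, hinv] at hab
      have := he hab
      simp only [Prod.mk.injEq] at this
      obtain ⟨rfl, h2⟩ := this
      rw [(τ x1).injective h2]
    · intro a ha
      obtain ⟨⟨b, i⟩, -, rfl⟩ := Finset.mem_image.1 ha
      rw [hinv, hardInst_apply e he]
      exact Finset.mem_image_of_mem _ (Finset.mem_image_of_mem _ (Finset.mem_insert_self _ _))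
  have hS0 : (0 : ℝ) < S := by exact_mod_cast hS
  have hmain : M * (q * (k : ℝ) ^ 2) ≤ M * (ρ * ((k : ℝ) ^ 2 * L)) := by
    calc M * (q * (k : ℝ) ^ 2)
        = ∑ τ : Fin q → Equiv.Perm (Fin (k ^ 2)), ((q * k ^ 2 : ℕ) : ℝ) := by
          rw [Finset.sum_const, Finset.card_univ, nsmul_eq_mul]; push_cast; rfl
      _ ≤ ∑ τ : Fin q → Equiv.Perm (Fin (k ^ 2)),
          ρ * ((1 : ℝ) / (S : ℝ)) * ∑ s, W s (hardInst e R τ) :=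
          Finset.sum_le_sum fun τ _ => hmatch τ
      _ = ρ * ((1 : ℝ) / (S : ℝ)) * ∑ s, ∑ τ : Fin q → Equiv.Perm (Fin (k ^ 2)),
          W s (hardInst e R τ) := by
          rw [← Finset.mul_sum, Finset.sum_comm]
      _ ≤ ρ * ((1 : ℝ) / (S : ℝ)) * ∑ s : Fin S, M * ((k : ℝ) ^ 2 * L) := by
          gcongr with s
          exact hseed s
      _ = _ := by
          rw [Finset.sum_const, Finset.card_univ, nsmul_eq_mul, Fintype.card_fin]
          field_simp
  have h5 := le_of_mul_le_mul_left hmain hM0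
  have h6 : (q : ℝ) ≤ ρ * L := by
    have : (q : ℝ) * (k : ℝ) ^ 2 ≤ (ρ * L) * (k : ℝ) ^ 2 := by linarith
    exact le_of_mul_le_mul_right this (by positivity)
  have h7 : ρ * (4 * q / (k : ℝ)) ≤ q / 2 := by
    rw [← mul_div_assoc, div_le_iff₀ hk0]
    have : (0 : ℝ) ≤ q := by positivity
    nlinarith
  have h8 : (q : ℝ) ≤ 2 * ρ * Real.log N := by
    rw [hL] at h6; linarith
  have h9 : (n : ℝ) ≤ 2 * (q * (k : ℝ) ^ 2) := by exact_mod_cast hq2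
  have h10 : 1 / 324 * (n : ℝ) / ρ ^ 4 ≤ Real.log N := by
    rw [div_le_iff₀ (by positivity)]
    have h11 : (q : ℝ) * (k : ℝ) ^ 2 ≤ (2 * ρ * Real.log N) * (81 * ρ ^ 2) := by gcongr
    have h12 : ρ ^ 3 ≤ ρ ^ 4 := pow_le_pow_right₀ hρ (by norm_num)
    have h13 := mul_le_mul_of_nonneg_left h12 hlogN
    nlinarith
  linarith
end

section
/- There exist absolute constants c > 0 and C ≥ 0 such that for every k ≥ 1 and b ≥ 1, setting n = k·b, for every real ρ ≥ 1 and every coordination protocol for many-to-one matching with n players and k good types each of supply b that achieves approximation ratio ρ, the message space satisfies Real.log N ≥ c·k/ρ⁴ − C; i.e., such a protocol has coordination complexity Ω(k/ρ⁴). -/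
open Finset in
/-- the good set seen by a player with position `x` in block `β` -/
def mmSet {G : Type} [DecidableEq G] {B m : ℕ} (t : ℕ) (e : Fin B × Fin m → G) (β : Fin B)
    (x : Fin m) (p : Equiv.Perm (Fin m)) : Finset G :=
  (Finset.univ.filter (fun y : Fin m => y.val < t ∨ y = x)).image (fun y => e (β, p y))

theorem mmSet_swap {G : Type} [DecidableEq G] {B m : ℕ} (t : ℕ) (e : Fin B × Fin m → G)
    (β : Fin B) (x y : Fin m) (hy : y.val < t ∨ y = x) (p : Equiv.Perm (Fin m)) :
    mmSet t e β x (p * Equiv.swap x y) = mmSet t e β x p := by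
  have key : ∀ z : Fin m, (z.val < t ∨ z = x) →
      ((Equiv.swap x y z).val < t ∨ Equiv.swap x y z = x) := by
    intro z hz
    rw [Equiv.swap_apply_def]
    split_ifs with h1 h2
    · exact hy
    · right; rfl
    · exact hz
  ext g
  simp only [mmSet, Finset.mem_image, Finset.mem_filter, Finset.mem_univ, true_and,
    Equiv.Perm.mul_apply]
  constructor
  · rintro ⟨z, hz, rfl⟩
    exact ⟨_, key z hz, rfl⟩
  · rintro ⟨z, hz, rfl⟩
    exact ⟨Equiv.swap x y z, key z hz, by simp⟩

theorem mm_count {G : Type} [DecidableEq G] {B m : ℕ} (t : ℕ) (e : Fin B × Fin m → G)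
    (he : Function.Injective e) (β : Fin B) (x : Fin m) (hx : t ≤ x.val) (F : Finset G → G) :
    (t + 1) * (Finset.univ.filter (fun p : Equiv.Perm (Fin m) =>
      F (mmSet t e β x p) = e (β, p x))).card ≤ Fintype.card (Equiv.Perm (Fin m)) := by
  set Y := Finset.univ.filter (fun y : Fin m => y.val < t ∨ y = x) with hY
  have hcard : Y.card = t + 1 := by
    have : Y = insert x (Finset.univ.filter (fun y : Fin m => y.val < t)) := by
      ext y; simp [hY, or_comm]
    rw [this, Finset.card_insert_of_notMem (by simp; omega), Fin.card_filter_val_lt]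
    have := x.2
    congr 1
    omega
  have h1 : ∀ y ∈ Y, (Finset.univ.filter (fun p : Equiv.Perm (Fin m) =>
      F (mmSet t e β x p) = e (β, p x))).card = (Finset.univ.filter (fun p : Equiv.Perm (Fin m) =>
      F (mmSet t e β x p) = e (β, p y))).card := by
    intro y hy
    have hy' : y.val < t ∨ y = x := by simpa [hY] using hy
    apply Finset.card_bij (fun p _ => p * Equiv.swap x y)
    · intro p hp
      simp only [Finset.mem_filter, Finset.mem_univ, true_and] at hp ⊢
      rw [mmSet_swap t e β x y hy']
      simpa using hp
    · intro p _ q _ h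
      exact mul_right_cancel h
    · intro p hp
      simp only [Finset.mem_filter, Finset.mem_univ, true_and] at hp ⊢
      refine ⟨p * Equiv.swap x y, ?_, by simp [mul_assoc]⟩
      rw [mmSet_swap t e β x y hy']
      simpa using hp
  rw [← hcard, ← smul_eq_mul, ← Finset.sum_const, Finset.sum_congr rfl h1]
  simp only [Finset.card_filter]
  rw [Finset.sum_comm]
  rw [← Finset.card_univ, Finset.card_eq_sum_ones]
  apply Finset.sum_le_sum
  intro p _
  rw [← Finset.card_filter]
  rw [Finset.card_le_one]
  intro y hy z hz
  simp only [Finset.mem_filter] at hy hz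
  have := he (hy.2.symm.trans hz.2)
  simpa using this

/-- number of lucky players in block `β` -/
def mmD {P G : Type} [Fintype P] [DecidableEq G] {B m : ℕ} (t : ℕ) (e : Fin B × Fin m → G)
    (h : P → Option (Fin B × Fin m)) (f : P → Finset G → G) (β : Fin B)
    (p : Equiv.Perm (Fin m)) : ℕ :=
  ∑ x : Fin m, (Finset.univ.filter (fun i : P =>
    h i = some (β, x) ∧ (t ≤ x.val ∧ f i (mmSet t e β x p) = e (β, p x)))).card

theorem mmD_le {P G : Type} [Fintype P] [DecidableEq G] {B m b : ℕ} (t : ℕ)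
    (e : Fin B × Fin m → G) (h : P → Option (Fin B × Fin m))
    (hf : ∀ q, (Finset.univ.filter (fun i : P => h i = some q)).card = b)
    (f : P → Finset G → G) (β : Fin B) (p : Equiv.Perm (Fin m)) :
    mmD t e h f β p ≤ m * b := by
  unfold mmD
  calc _ ≤ ∑ x : Fin m, b := by
        apply Finset.sum_le_sum
        intro x _
        rw [← hf (β, x)]
        apply Finset.card_le_card
        intro i; simp; tauto
    _ = _ := by simp

theorem mmD_mean {P G : Type} [Fintype P] [DecidableEq G] {B m b : ℕ} (t : ℕ)
    (e : Fin B × Fin m → G) (he : Function.Injective e) (h : P → Option (Fin B × Fin m))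
    (hf : ∀ q, (Finset.univ.filter (fun i : P => h i = some q)).card = b)
    (f : P → Finset G → G) (β : Fin B) :
    (t + 1) * ∑ p, mmD t e h f β p ≤ m * b * Fintype.card (Equiv.Perm (Fin m)) := by
  unfold mmD
  rw [Finset.sum_comm, Finset.mul_sum]
  calc _ ≤ ∑ x : Fin m, b * Fintype.card (Equiv.Perm (Fin m)) := by
        apply Finset.sum_le_sum
        intro x _
        rw [← hf (β, x)]
        by_cases hx : t ≤ x.val
        · simp only [hx, true_and]
          simp only [← Finset.filter_filter]
          simp only [Finset.card_filter _ (Finset.filter _ _)]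
          rw [Finset.sum_comm, Finset.mul_sum, ← smul_eq_mul, ← Finset.sum_const]
          apply Finset.sum_le_sum
          intro i _
          rw [← Finset.card_filter]
          exact mm_count t e he β x hx (f i)
        · simp [hx]
    _ = _ := by simp [mul_assoc]

theorem mm_mgf {P G : Type} [Fintype P] [DecidableEq G] {B m b : ℕ} (hm : 0 < m) (hb : 0 < b)
    (t : ℕ)
    (e : Fin B × Fin m → G) (he : Function.Injective e) (h : P → Option (Fin B × Fin m))
    (hf : ∀ q, (Finset.univ.filter (fun i : P => h i = some q)).card = b)
    (f : P → Finset G → G) (β : Fin B) :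
    ∑ p, Real.exp ((mmD t e h f β p : ℝ) / (m * b)) ≤
      Fintype.card (Equiv.Perm (Fin m)) * Real.exp (2 / (t + 1)) := by
  have hmb : (0:ℝ) < m * b := by positivity
  have h1 : ∀ p, Real.exp ((mmD t e h f β p : ℝ) / (m * b)) ≤
      1 + 2 * ((mmD t e h f β p : ℝ) / (m * b)) := by
    intro p
    set u := (mmD t e h f β p : ℝ) / (m * b) with hu
    have hu0 : 0 ≤ u := by positivity
    have hu1 : u ≤ 1 := by
      rw [hu, div_le_one hmb]
      exact_mod_cast mmD_le t e h hf f β p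
    have := convexOn_exp.2 (Set.mem_univ (0:ℝ)) (Set.mem_univ (1:ℝ))
      (sub_nonneg.2 hu1) hu0 (by ring)
    simp only [smul_eq_mul, mul_zero, mul_one, zero_add, Real.exp_zero] at this
    have := Real.exp_one_lt_d9
    nlinarith
  have h2 := mmD_mean t e he h hf f β
  have h3 : ((t:ℝ) + 1) * ∑ p, (mmD t e h f β p : ℝ) ≤
      m * b * Fintype.card (Equiv.Perm (Fin m)) := by exact_mod_cast h2
  have h4 : 1 + 2 / ((t:ℝ) + 1) ≤ Real.exp (2 / (t + 1)) := by
    have := Real.add_one_le_exp (2 / ((t:ℝ) + 1)); linarith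
  calc _ ≤ ∑ p, (1 + 2 * ((mmD t e h f β p : ℝ) / (m * b))) := Finset.sum_le_sum fun p _ => h1 p
    _ = Fintype.card (Equiv.Perm (Fin m)) + 2 * ((∑ p, (mmD t e h f β p : ℝ)) / (m * b)) := by
        rw [Finset.sum_add_distrib, ← Finset.mul_sum, ← Finset.sum_div]; simp
    _ ≤ Fintype.card (Equiv.Perm (Fin m)) * (1 + 2 / (t + 1)) := by
        have : (∑ p, (mmD t e h f β p : ℝ)) / (m * b) ≤
            Fintype.card (Equiv.Perm (Fin m)) / (t + 1) := by
          rw [div_le_div_iff₀ hmb (by positivity)]; linarith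
        have e1 : (Fintype.card (Equiv.Perm (Fin m)) : ℝ) * (1 + 2 / (t + 1)) =
          Fintype.card (Equiv.Perm (Fin m)) +
          2 * (Fintype.card (Equiv.Perm (Fin m)) / (t + 1)) := by ring
        rw [e1]; linarith
    _ ≤ _ := by gcongr

/-- instance -/
def mmA {P G : Type} [DecidableEq G] {B m : ℕ} (t : ℕ) (e : Fin B × Fin m → G)
    (h : P → Option (Fin B × Fin m)) (τ : Fin B → Equiv.Perm (Fin m)) (i : P) : Finset G :=
  match h i with
  | none => ∅
  | some q => mmSet t e q.1 q.2 (τ q.1)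

theorem mm_welfare {P G : Type} [Fintype P] [Fintype G] [DecidableEq G] {B m b : ℕ}
    (t : ℕ) (htm : t ≤ m) (e : Fin B × Fin m → G) (h : P → Option (Fin B × Fin m))
    (f : P → Finset G → G) (τ : Fin B → Equiv.Perm (Fin m)) :
    ∑ j : G, min b ((Finset.univ.filter (fun i : P =>
      f i (mmA t e h τ i) = j ∧ j ∈ mmA t e h τ i)).card) ≤
      B * t * b + ∑ β, mmD t e h f β (τ β) := by
  classical
  set T : Finset G := (Finset.univ : Finset (Fin B × Fin t)).image
    (fun q => e (q.1, τ q.1 (Fin.castLE htm q.2))) with hT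
  have hTc : T.card ≤ B * t := by
    refine Finset.card_image_le.trans ?_
    simp
  rw [← Finset.sum_add_sum_compl T]
  apply add_le_add
  · calc _ ≤ ∑ j ∈ T, b := Finset.sum_le_sum fun j _ => min_le_left _ _
      _ = T.card * b := by simp
      _ ≤ _ := Nat.mul_le_mul_right _ hTc
  · calc _ ≤ ∑ j ∈ Tᶜ, (Finset.univ.filter (fun i : P =>
      f i (mmA t e h τ i) = j ∧ j ∈ mmA t e h τ i)).card :=
          Finset.sum_le_sum fun j _ => min_le_right _ _
      _ ≤ (Finset.univ.biUnion (fun q : Fin B × Fin m => Finset.univ.filter (fun i : P =>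
        h i = some (q.1, q.2) ∧ (t ≤ q.2.val ∧
          f i (mmSet t e q.1 q.2 (τ q.1)) = e (q.1, τ q.1 q.2))))).card := by
          rw [← Finset.card_biUnion]
          · apply Finset.card_le_card
            intro i hi
            simp only [Finset.mem_biUnion, Finset.mem_filter, Finset.mem_univ, true_and,
              Finset.mem_compl] at hi ⊢
            obtain ⟨j, hj, hfj, hjA⟩ := hi
            unfold mmA at hfj hjA
            rcases hh : h i with _ | q
            · rw [hh] at hjA; simp at hjA
            · rw [hh] at hjA hfj
              simp only at hjA hfj
              refine ⟨q, rfl, ?_⟩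
              have hjA' := hjA
              unfold mmSet at hjA'
              simp only [Finset.mem_image, Finset.mem_filter, Finset.mem_univ, true_and] at hjA'
              obtain ⟨y, hy, rfl⟩ := hjA'
              have hyt : ¬ y.val < t := by
                intro hlt
                apply hj
                rw [hT, Finset.mem_image]
                exact ⟨(q.1, ⟨y.val, hlt⟩), Finset.mem_univ _, rfl⟩
              have hyq : y = q.2 := hy.resolve_left hyt
              subst hyq
              exact ⟨by omega, hfj⟩
          · intro j _ j' _ hne
            rw [Function.onFun, Finset.disjoint_left]
            intro i hi hi'
            simp only [Finset.mem_filter] at hi hi'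
            exact hne (hi.2.1.symm.trans hi'.2.1)
      _ ≤ _ := Finset.card_biUnion_le
      _ = _ := by
          rw [Fintype.sum_prod_type]; rfl

theorem mm_core {P G : Type} [Fintype P] [Fintype G] [DecidableEq G] {B m b N : ℕ}
    (hm : 0 < m) (hb : 0 < b) (hN : 0 < N)
    (t : ℕ) (htm : t ≤ m) (e : Fin B × Fin m → G) (he : Function.Injective e)
    (h : P → Option (Fin B × Fin m))
    (hf : ∀ q, (Finset.univ.filter (fun i : P => h i = some q)).card = b)
    (f : Fin N → P → Finset G → G) (E : (Fin B → Equiv.Perm (Fin m)) → Fin N) (w : ℝ)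
    (hw : (Fintype.card (Fin B → Equiv.Perm (Fin m)) : ℝ) * (w * (m * b)) ≤
      ∑ τ : Fin B → Equiv.Perm (Fin m), ∑ j : G, ((min b ((Finset.univ.filter (fun i : P =>
      f (E τ) i (mmA t e h τ i) = j ∧ j ∈ mmA t e h τ i)).card) : ℕ) : ℝ)) :
    w - B * t / m - B * (2 / (t + 1)) ≤ Real.log N := by
  classical
  have hm' : (0:ℝ) < m := by positivity
  have hb' : (0:ℝ) < b := by positivity
  have hmb : (0:ℝ) < m * b := by positivity
  set X : (Fin B → Equiv.Perm (Fin m)) → Fin N → ℝ := fun τ n =>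
    ∑ β, (mmD t e h (f n) β (τ β) : ℝ) / (m * b) with hX
  set a : ℝ := w - B * t / m with ha
  set M : ℝ := (Fintype.card (Fin B → Equiv.Perm (Fin m)) : ℝ) with hM
  have hM0 : 0 < M := by rw [hM]; exact_mod_cast Fintype.card_pos
  have h1 : M * a ≤ ∑ τ, X τ (E τ) := by
    have : M * (w * (m * b)) ≤ ∑ τ, (B * t * b + X τ (E τ) * (m * b)) := by
      refine hw.trans (Finset.sum_le_sum fun τ _ => ?_)
      have := mm_welfare (b := b) t htm e h (f (E τ)) τ
      have h2 : X τ (E τ) * (m * b) = ∑ β, (mmD t e h (f (E τ)) β (τ β) : ℝ) := by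
        rw [hX]; simp only
        rw [← Finset.sum_div, div_mul_cancel₀ _ hmb.ne']
      rw [h2]
      exact_mod_cast this
    rw [Finset.sum_add_distrib, ← Finset.sum_mul Finset.univ (fun τ => X τ (E τ)),
      Finset.sum_const, Finset.card_univ, nsmul_eq_mul, ← hM] at this
    have h3 : M * a * (m * b) = M * (w * (m * b)) - M * (B * t * b) := by
      rw [ha]; field_simp
    refine le_of_mul_le_mul_right ?_ hmb
    linarith
  have h2 : M * Real.exp a ≤ ∑ τ, Real.exp (X τ (E τ)) := by
    have : ∀ τ, Real.exp a * (1 - a + X τ (E τ)) ≤ Real.exp (X τ (E τ)) := by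
      intro τ
      have h3 := Real.add_one_le_exp (X τ (E τ) - a)
      have h4 : Real.exp (X τ (E τ)) = Real.exp a * Real.exp (X τ (E τ) - a) := by
        rw [← Real.exp_add]; congr 1; ring
      rw [h4]
      apply mul_le_mul_of_nonneg_left _ (Real.exp_pos a).le
      linarith
    refine le_trans ?_ (Finset.sum_le_sum fun τ _ => this τ)
    rw [← Finset.mul_sum, Finset.sum_add_distrib, Finset.sum_const, Finset.card_univ,
      nsmul_eq_mul, ← hM, mul_comm]
    apply mul_le_mul_of_nonneg_left _ (Real.exp_pos a).le
    linarith
  have h3 : ∑ τ, Real.exp (X τ (E τ)) ≤ N * (M * Real.exp (B * (2 / (t + 1)))) := by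
    calc _ ≤ ∑ τ, ∑ n, Real.exp (X τ n) := Finset.sum_le_sum fun τ _ =>
          Finset.single_le_sum (f := fun n => Real.exp (X τ n))
            (fun n _ => (Real.exp_pos _).le) (Finset.mem_univ (E τ))
      _ = ∑ n, ∑ τ, Real.exp (X τ n) := Finset.sum_comm
      _ ≤ ∑ n : Fin N, M * Real.exp (B * (2 / (t + 1))) := by
          apply Finset.sum_le_sum
          intro n _
          calc _ = ∏ β : Fin B, ∑ p, Real.exp ((mmD t e h (f n) β p : ℝ) / (m * b)) := by
                rw [Finset.prod_univ_sum, Fintype.piFinset_univ]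
                apply Finset.sum_congr rfl
                intro τ _
                rw [hX]; simp only
                rw [Real.exp_sum]
            _ ≤ ∏ β : Fin B, (Fintype.card (Equiv.Perm (Fin m)) * Real.exp (2 / (t + 1))) :=
                Finset.prod_le_prod (fun β _ => Finset.sum_nonneg fun p _ => (Real.exp_pos _).le)
                  fun β _ => mm_mgf hm hb t e he h hf (f n) β
            _ = _ := by
                rw [Finset.prod_const, Finset.card_univ, Fintype.card_fin, mul_pow,
                  ← Real.exp_nat_mul, hM]
                congr 1
                rw [Fintype.card_fun, Fintype.card_fin]
                push_cast
                rfl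
      _ = _ := by simp
  have hN' : (0:ℝ) < N := by positivity
  rw [Real.le_log_iff_exp_le hN', Real.exp_sub, div_le_iff₀ (Real.exp_pos _)]
  have := h2.trans h3
  refine le_of_mul_le_mul_left ?_ hM0
  linarith

theorem mm_match {P G : Type} [Fintype P] [DecidableEq G] {B m b : ℕ}
    (t : ℕ) (e : Fin B × Fin m → G) (he : Function.Injective e)
    (h : P → Option (Fin B × Fin m))
    (hf : ∀ q, (Finset.univ.filter (fun i : P => h i = some q)).card = b)
    (τ : Fin B → Equiv.Perm (Fin m)) :
    ∃ μ : P → Option G, (∀ i j, μ i = some j → j ∈ mmA t e h τ i) ∧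
      (∀ j, (Finset.univ.filter (fun i => μ i = some j)).card ≤ b) ∧
      B * m * b ≤ (Finset.univ.filter (fun i => μ i ≠ none)).card := by
  classical
  refine ⟨fun i => (h i).map (fun q => e (q.1, τ q.1 q.2)), ?_, ?_, ?_⟩
  · intro i j hij
    simp only [Option.map_eq_some_iff] at hij
    obtain ⟨q, hq, rfl⟩ := hij
    unfold mmA
    rw [hq]
    simp only [mmSet, Finset.mem_image, Finset.mem_filter, Finset.mem_univ, true_and]
    exact ⟨q.2, Or.inr rfl, rfl⟩
  · intro j
    by_cases hj : ∃ q : Fin B × Fin m, e q = j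
    · obtain ⟨⟨β, y⟩, rfl⟩ := hj
      rw [← hf (β, (τ β).symm y)]
      apply Finset.card_le_card
      intro i hi
      simp only [Finset.mem_filter, Finset.mem_univ, true_and, Option.map_eq_some_iff] at hi ⊢
      obtain ⟨⟨β', x⟩, hq, hq2⟩ := hi
      have := he hq2
      simp only [Prod.mk.injEq] at this
      obtain ⟨rfl, rfl⟩ := this
      simpa using hq
    · rw [Finset.card_eq_zero.2]
      · exact Nat.zero_le _
      · ext i
        simp only [Finset.mem_filter, Finset.mem_univ, true_and, Option.map_eq_some_iff,
          Finset.notMem_empty, iff_false]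
        rintro ⟨q, _, hq⟩
        exact hj ⟨_, hq⟩
  · calc B * m * b = ∑ q : Fin B × Fin m, (Finset.univ.filter (fun i : P => h i = some q)).card := by
          simp [hf]
      _ = (Finset.univ.biUnion (fun q : Fin B × Fin m =>
            Finset.univ.filter (fun i : P => h i = some q))).card := by
          rw [Finset.card_biUnion]
          intro q _ q' _ hne
          rw [Function.onFun, Finset.disjoint_left]
          intro i hi hi'
          simp only [Finset.mem_filter] at hi hi'
          exact hne (Option.some.inj (hi.2.symm.trans hi'.2))
      _ ≤ _ := by
          apply Finset.card_le_card
          intro i hi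
          simp only [Finset.mem_biUnion, Finset.mem_filter, Finset.mem_univ, true_and] at hi ⊢
          obtain ⟨q, hq⟩ := hi
          simp [hq]

theorem mm_setup (k b m : ℕ) : ∃ (e : Fin (k / m) × Fin m → Fin k)
    (h : Fin (k * b) → Option (Fin (k / m) × Fin m)), Function.Injective e ∧
    ∀ q, (Finset.univ.filter (fun i => h i = some q)).card = b := by
  classical
  let e : Fin (k / m) × Fin m → Fin k := fun q =>
    Fin.castLE (Nat.div_mul_le_self k m) (finProdFinEquiv q)
  have he : Function.Injective e := by
    intro q q' hq
    exact finProdFinEquiv.injective (Fin.castLE_injective _ hq)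
  refine ⟨e, fun i => Function.partialInv e (finProdFinEquiv.symm i).1, he, ?_⟩
  intro q
  have : (Finset.univ.filter (fun i : Fin (k * b) =>
      Function.partialInv e (finProdFinEquiv.symm i).1 = some q)) =
      (Finset.univ : Finset (Fin b)).image (fun r => finProdFinEquiv (e q, r)) := by
    ext i
    have hp := Function.Injective.isPartialInv he q (finProdFinEquiv.symm i).1
    simp only [Finset.mem_filter, Finset.mem_univ, true_and, Finset.mem_image]
    rw [hp]
    constructor
    · intro hq
      refine ⟨(finProdFinEquiv.symm i).2, ?_⟩
      rw [hq]; exact finProdFinEquiv.apply_symm_apply i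
    · rintro ⟨r, rfl⟩
      simp
  rw [this, Finset.card_image_of_injective]
  · simp
  · intro r r' hr
    simpa using finProdFinEquiv.injective hr

/-- **Coordination complexity lower bound for many-to-one matchings.**
There are absolute constants `c > 0` and `C ≥ 0` such that for every `k ≥ 1`, `b ≥ 1`,
setting `n = k·b`, every `ρ ≥ 1`, and every coordination protocol (seed space `Fin S`,
encoder `σ`, decoder `π`, message space `Fin N`) for many-to-one matching with `n` players
and `k` good types of supply `b` each that achieves approximation ratio `ρ`
(for every instance `A` and every capacitated assignment `μ`, the size of `μ` is at most
`ρ` times the expected realized welfare), the message space satisfies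
`Real.log N ≥ c·k/ρ⁴ − C`. -/
theorem many_to_one_matching_coordination_lower_bound :
    ∃ c C : ℝ, 0 < c ∧ 0 ≤ C ∧
      ∀ (k b : ℕ), 1 ≤ k → 1 ≤ b →
      ∀ (ρ : ℝ), 1 ≤ ρ →
      ∀ (N S : ℕ), 0 < N → 0 < S →
      ∀ (σ : Fin S → (Fin (k * b) → Finset (Fin k)) → Fin N)
        (π : Fin S → Fin (k * b) → Finset (Fin k) → Fin N → Fin k),
      (∀ (A : Fin (k * b) → Finset (Fin k)) (μ : Fin (k * b) → Option (Fin k)),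
        (∀ i j, μ i = some j → j ∈ A i) →
        (∀ j : Fin k, ((Finset.univ.filter (fun i => μ i = some j)).card ≤ b)) →
        (((Finset.univ.filter (fun i => μ i ≠ none)).card : ℝ) ≤
          ρ * ((1 : ℝ) / (S : ℝ)) *
            ∑ s : Fin S, ∑ j : Fin k,
              ((min b ((Finset.univ.filter (fun i : Fin (k * b) =>
                π s i (A i) (σ s A) = j ∧ j ∈ A i)).card) : ℕ) : ℝ))) →
      Real.log N ≥ c * (k : ℝ) / ρ ^ 4 - C := by
  refine ⟨1 / 162, 1, by norm_num, by norm_num, ?_⟩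
  intro k b hk hb ρ hρ N S hN hS σ π hyp
  set t : ℕ := ⌈8 * ρ⌉₊ with ht
  have ht1 : 8 * ρ ≤ t := Nat.le_ceil _
  have ht2 : (t : ℝ) ≤ 9 * ρ := by
    have := Nat.ceil_lt_add_one (show 0 ≤ 8 * ρ by linarith)
    rw [← ht] at this
    linarith
  have htpos : 0 < t := by
    have : (0:ℝ) < t := by linarith
    exact_mod_cast this
  set m : ℕ := t * t with hm
  have hmpos : 0 < m := Nat.mul_pos htpos htpos
  have htm : t ≤ m := Nat.le_mul_of_pos_left t htpos
  obtain ⟨B, hB, e, h, he, hf⟩ : ∃ B, B = k / m ∧ ∃ (e : Fin B × Fin m → Fin k)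
    (h : Fin (k * b) → Option (Fin B × Fin m)), Function.Injective e ∧
    ∀ q, (Finset.univ.filter (fun i => h i = some q)).card = b := ⟨_, rfl, mm_setup k b m⟩
  have hS' : (0:ℝ) < S := by positivity
  have hρ0 : (0:ℝ) < ρ := by linarith
  let Wf : Fin S → (Fin B → Equiv.Perm (Fin m)) → ℝ := fun s τ =>
    ∑ j : Fin k, ((min b ((Finset.univ.filter (fun i : Fin (k * b) =>
      π s i (mmA t e h τ i) (σ s (mmA t e h τ)) = j ∧ j ∈ mmA t e h τ i)).card) : ℕ) : ℝ)
  have h1 : ∀ τ, (S : ℝ) * ((B / ρ) * (m * b)) ≤ ∑ s, Wf s τ := by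
    intro τ
    obtain ⟨μ, hμ1, hμ2, hμ3⟩ := mm_match t e he h hf τ
    have h2 := hyp (mmA t e h τ) μ hμ1 hμ2
    have h3 : ((B : ℝ) * m * b) ≤ ((Finset.univ.filter (fun i => μ i ≠ none)).card : ℝ) := by
      exact_mod_cast hμ3
    have h4 : (B : ℝ) * m * b ≤ ρ * (1 / S) * ∑ s, Wf s τ := h3.trans h2
    have h5 : (S : ℝ) * ((B / ρ) * (m * b)) = (S / ρ) * (B * m * b) := by
      field_simp
    have h6 : ∑ s, Wf s τ = (S / ρ) * (ρ * (1 / S) * ∑ s, Wf s τ) := by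
      field_simp
    rw [h5, h6]
    exact mul_le_mul_of_nonneg_left h4 (by positivity)
  have h2 : ∃ s, (Fintype.card (Fin B → Equiv.Perm (Fin m)) : ℝ) * ((B / ρ) * (m * b)) ≤
      ∑ τ, Wf s τ := by
    by_contra hcon
    push Not at hcon
    have h3 : ∑ s, ∑ τ, Wf s τ <
        ∑ s : Fin S, (Fintype.card (Fin B → Equiv.Perm (Fin m)) : ℝ) * ((B / ρ) * (m * b)) :=
      Finset.sum_lt_sum_of_nonempty ⟨⟨0, hS⟩, Finset.mem_univ _⟩ fun s _ => hcon s
    have h4 : ∑ τ : Fin B → Equiv.Perm (Fin m), (S : ℝ) * ((B / ρ) * (m * b)) ≤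
        ∑ τ, ∑ s, Wf s τ := Finset.sum_le_sum fun τ _ => h1 τ
    rw [Finset.sum_comm] at h3
    simp only [Finset.sum_const, Finset.card_univ, nsmul_eq_mul, Fintype.card_fin] at h3 h4
    linarith
  obtain ⟨s, hs⟩ := h2
  have h3 := mm_core hmpos hb hN t htm e he h hf (fun n i a => π s i a n)
    (fun τ => σ s (mmA t e h τ)) (B / ρ) hs
  have htR : (0:ℝ) < t := by linarith
  have e1 : (B : ℝ) * t / m ≤ B / ρ / 4 := by
    have : (B : ℝ) * t / m = B * (1 / t) := by
      rw [hm]; push_cast; field_simp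
    rw [this]
    have h5 : 1 / (t:ℝ) ≤ 1 / (8 * ρ) := one_div_le_one_div_of_le (by positivity) ht1
    have h6 : (B : ℝ) / ρ / 4 = B * (1 / (8 * ρ)) * 2 := by field_simp; ring
    rw [h6]
    have h7 : (B : ℝ) * (1 / t) ≤ B * (1 / (8 * ρ)) := by gcongr
    have h8 : 0 ≤ (B : ℝ) * (1 / (8 * ρ)) := by positivity
    linarith
  have e2 : (B : ℝ) * (2 / (t + 1)) ≤ B / ρ / 4 := by
    have h5 : 2 / ((t:ℝ) + 1) ≤ 2 / (8 * ρ) := by gcongr; linarith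
    have h6 : (B : ℝ) / ρ / 4 = B * (2 / (8 * ρ)) := by field_simp; ring
    rw [h6]; gcongr
  have e3 : (B : ℝ) / ρ / 2 ≤ Real.log N := by linarith
  have hmR : (m : ℝ) ≤ 81 * ρ ^ 2 := by
    rw [hm]; push_cast; nlinarith
  have hkB : (k : ℝ) ≤ m * (B + 1) := by
    have := (Nat.lt_mul_div_succ k hmpos).le
    rw [← hB] at this
    exact_mod_cast this
  have e4 : (k : ℝ) ≤ 81 * ρ ^ 2 * (B + 1) :=
    hkB.trans (mul_le_mul_of_nonneg_right hmR (by positivity))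
  have e5 : 1 / 162 * (k : ℝ) / ρ ^ 4 ≤ B / ρ / 2 + 1 := by
    have h5 : 1 / 162 * (k : ℝ) / ρ ^ 4 ≤ 1 / 162 * (81 * ρ ^ 2 * (B + 1)) / ρ ^ 4 := by gcongr
    have h6 : 1 / 162 * (81 * ρ ^ 2 * ((B:ℝ) + 1)) / ρ ^ 4 = (B + 1) / 2 * (1 / ρ) * (1 / ρ) := by
      field_simp; norm_num
    have h7 : 1 / ρ ≤ 1 := by rw [div_le_one hρ0]; exact hρ
    have h8 : ((B:ℝ) + 1) / 2 * (1 / ρ) * (1 / ρ) ≤ (B + 1) / 2 * (1 / ρ) * 1 := by gcongr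
    have h9 : ((B:ℝ) + 1) / 2 * (1 / ρ) * 1 = B / ρ / 2 + (1 / ρ) / 2 := by ring
    linarith
  linarith
end

section
/- Let E be a real inner product space, F a metric space, s ⊆ E a nonempty set, η > 0, K ≥ 0, α ≥ 0, and L : E → F → ℝ. Suppose: (i) for every x ∈ s the function λ ↦ L x λ is Lipschitz with constant K; (ii) the function x ↦ L x λ̂ is η-strongly concave on s; (iii) x• ∈ s maximizes x ↦ L x λ• over s and x̂ ∈ s maximizes x ↦ L x λ̂ over s; and (iv) dist(λ•, λ̂) ≤ α. Then ‖x̂ − x•‖ ≤ 2·√(K·α/η). (With K = √(n·k), as for the regularized Lagrangian of a linearly separable convex program with n players and k coupling constraints whose constraint functions take values in [0,1], this gives the paper's bound ‖x̂ − x•‖ ≤ 2·√α·(nk)^{1/4}/√η.) -/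
/-- **Closeness of primal maximizers from closeness of dual variables.**
If `λ ↦ L x λ` is `K`-Lipschitz for every `x ∈ s`, `x ↦ L x λ̂` is `η`-strongly concave on
`s`, `x•` maximizes `x ↦ L x λ•` over `s`, `x̂` maximizes `x ↦ L x λ̂` over `s`, and
`dist(λ•, λ̂) ≤ α`, then `‖x̂ − x•‖ ≤ 2·√(K·α/η)`. -/
theorem primal_close_of_dual_close
    {E F : Type*} [NormedAddCommGroup E] [InnerProductSpace ℝ E] [MetricSpace F]
    (s : Set E) (η K α : ℝ) (hη : 0 < η) (hK : 0 ≤ K) (hα : 0 ≤ α)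
    (L : E → F → ℝ) (lam₀ lamHat : F) (x₀ xHat : E)
    (hLip : ∀ x ∈ s, LipschitzWith K.toNNReal (L x))
    (hconc : StrongConcaveOn s η (fun x => L x lamHat))
    (hx₀ : x₀ ∈ s) (hmax₀ : ∀ x ∈ s, L x lam₀ ≤ L x₀ lam₀)
    (hxHat : xHat ∈ s) (hmaxHat : ∀ x ∈ s, L x lamHat ≤ L xHat lamHat)
    (hdist : dist lam₀ lamHat ≤ α) :
    ‖xHat - x₀‖ ≤ 2 * Real.sqrt (K * α / η) := by
  have h1 : L xHat lamHat - L xHat lam₀ ≤ K * α := by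
    have h := (hLip xHat hxHat).dist_le_mul lamHat lam₀
    rw [Real.coe_toNNReal K hK, dist_comm lamHat, Real.dist_eq] at h
    exact (le_abs_self _).trans (h.trans (mul_le_mul_of_nonneg_left hdist hK))
  have h2 : L x₀ lam₀ - L x₀ lamHat ≤ K * α := by
    have h := (hLip x₀ hx₀).dist_le_mul lam₀ lamHat
    rw [Real.coe_toNNReal K hK, Real.dist_eq] at h
    exact (le_abs_self _).trans (h.trans (mul_le_mul_of_nonneg_left hdist hK))
  have h3 := hmax₀ xHat hxHat
  have h4 := hmaxHat x₀ hx₀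
  have key : η / 2 * ‖x₀ - xHat‖ ^ 2 ≤ L xHat lamHat - L x₀ lamHat := by
    obtain ⟨hs, hc⟩ := hconc
    have hg : ∀ t : ℝ, 0 < t → t < 1 →
        (1 - t) * (η / 2 * ‖x₀ - xHat‖ ^ 2) ≤ L xHat lamHat - L x₀ lamHat := by
      intro t ht0 ht1
      have hb : 0 ≤ 1 - t := by linarith
      have hab : t + (1 - t) = 1 := by ring
      have ha := hc hx₀ hxHat ht0.le hb hab
      have hm := hmaxHat _ (hs hx₀ hxHat ht0.le hb hab)
      simp only [smul_eq_mul] at ha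
      refine le_of_mul_le_mul_left ?_ ht0
      linarith
    generalize η / 2 * ‖x₀ - xHat‖ ^ 2 = c at hg
    by_contra! hlt
    have hcpos : 0 < c := by linarith
    have h := hg ((c - (L xHat lamHat - L x₀ lamHat)) / (2 * c))
      (div_pos (by linarith) (by linarith)) (by rw [div_lt_one (by linarith)]; linarith)
    have he : (1 - (c - (L xHat lamHat - L x₀ lamHat)) / (2 * c)) * c
        = (c + (L xHat lamHat - L x₀ lamHat)) / 2 := by
      field_simp
      ring
    linarith
  rw [norm_sub_rev x₀ xHat] at key
  have h5 : (‖xHat - x₀‖ / 2) ^ 2 ≤ K * α / η := by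
    rw [le_div_iff₀ hη]
    linarith
  have h6 := Real.le_sqrt_of_sq_le h5
  linarith
end

section
/- For the approximate counter C: (a) for every t ≥ 0, |C(t) − S(t)| ≤ r; and (b) for every T ≥ 1, the number of update steps t ∈ {1, …, T} satisfies r · |{t ∈ {1,…,T} : C(t) ≠ C(t−1)}| ≤ Σ_{i=1}^{T} |τ(i)|. -/
/-- **Accuracy and update count of the approximate counter.** For a stream
`τ : ℕ → ℤ` with values in `{−1, 0, 1}`, running sum `S(t) = Σ_{i=1}^t τ(i)`, and the
counter `C` defined by `C(0) = 0` and, for `t ≥ 1`, `C(t) = C(t−1) + r` if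
`C(t−1) ≤ S(t) − r`, `C(t) = C(t−1) − r` if `C(t−1) ≥ S(t) + r`, and `C(t) = C(t−1)`
otherwise: (a) `|C(t) − S(t)| ≤ r` for all `t`; and (b) for every `T ≥ 1`,
`r · #{t ∈ {1,…,T} : C(t) ≠ C(t−1)} ≤ Σ_{i=1}^T |τ(i)|`. -/
theorem approxCount_accuracy_and_updates
    (r : ℤ) (hr : 1 ≤ r) (τ : ℕ → ℤ)
    (hτ : ∀ t : ℕ, 1 ≤ t → τ t = -1 ∨ τ t = 0 ∨ τ t = 1)
    (S : ℕ → ℤ) (hS : ∀ t : ℕ, S t = ∑ i ∈ Finset.Icc 1 t, τ i)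
    (C : ℕ → ℤ) (hC0 : C 0 = 0)
    (hCrec : ∀ t : ℕ, 1 ≤ t →
      C t = if C (t - 1) ≤ S t - r then C (t - 1) + r
            else if S t + r ≤ C (t - 1) then C (t - 1) - r
            else C (t - 1)) :
    (∀ t : ℕ, |C t - S t| ≤ r) ∧
    (∀ T : ℕ, 1 ≤ T →
      r * (((Finset.Icc 1 T).filter (fun t => C t ≠ C (t - 1))).card : ℤ) ≤
        ∑ i ∈ Finset.Icc 1 T, |τ i|) := by
  have key : ∀ t : ℕ, |C t - S t| ≤ r - 1 ∧
      r * (((Finset.Icc 1 t).filter (fun t => C t ≠ C (t - 1))).card : ℤ) + |C t - S t| ≤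
        ∑ i ∈ Finset.Icc 1 t, |τ i| := by
    intro t
    induction t with
    | zero =>
      have h0 : S 0 = 0 := by simp [hS]
      simp [hC0, h0]
      omega
    | succ n ih =>
      obtain ⟨ih1, ih2⟩ := ih
      have hs : S (n + 1) = S n + τ (n + 1) := by
        rw [hS, hS, Finset.sum_Icc_succ_top (by omega)]
      have hc := hCrec (n + 1) (by omega)
      have ht := hτ (n + 1) (by omega)
      have hI : Finset.Icc 1 (n + 1) = insert (n + 1) (Finset.Icc 1 n) := by
        ext x
        simp only [Finset.mem_Icc, Finset.mem_insert]
        omega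
      rw [Finset.sum_Icc_succ_top (by omega), hI, Finset.filter_insert]
      simp only [Nat.add_sub_cancel] at hc ⊢
      by_cases h : C (n + 1) = C n
      · rw [if_neg (by simpa using h)]
        generalize r * (_ : ℤ) = K at *
        generalize ∑ i ∈ Finset.Icc 1 n, |τ i| = M at *
        clear hCrec hS hτ hI hC0
        split_ifs at hc <;> grind
      · rw [if_pos h, Finset.card_insert_of_notMem (by simp)]
        push_cast
        rw [mul_add]
        simp only [mul_one]
        generalize r * (_ : ℤ) = K at *
        generalize ∑ i ∈ Finset.Icc 1 n, |τ i| = M at *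
        clear hCrec hS hτ hI hC0
        split_ifs at hc <;> grind
  refine ⟨fun t => by linarith [(key t).1], fun T _ => ?_⟩
  linarith [(key T).2, abs_nonneg (C T - S T)]
end

section
/- For any profile P : Fin n → Finset E, any player i₀, and any path Q : Finset E, letting P' = Function.update P i₀ Q be the profile in which player i₀ deviates from P(i₀) to Q, one has the exact identity Σ_{e ∈ P(i₀)} c(e, ℓ_P(e)) − Σ_{e ∈ Q} c(e, ℓ_{P'}(e)) = Ψ(P) − Ψ(P'). That is, the change in a deviating player's cost equals the change in Rosenthal's potential. -/
/-- The load of edge `e` under profile `P`: the number of players whose path contains `e`. -/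
def congestionLoad {E : Type*} [Fintype E] [DecidableEq E] {n : ℕ} (P : Fin n → Finset E) (e : E) : ℕ :=
  (Finset.univ.filter fun i => e ∈ P i).card

/-- Rosenthal's potential `Ψ(P) = Σ_e Σ_{j=1}^{ℓ_P(e)} c(e, j)`. -/
def rosenthalPotential {E : Type*} [Fintype E] [DecidableEq E] {n : ℕ} (c : E → ℕ → ℝ)
    (P : Fin n → Finset E) : ℝ :=
  ∑ e : E, ∑ j ∈ Finset.Icc 1 (congestionLoad P e), c e j

/-- Load of an edge after removing player `i₀`, plus the contribution of `i₀`. -/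
theorem congestionLoad_eq_remove {E : Type*} [Fintype E] [DecidableEq E] {n : ℕ}
    (P : Fin n → Finset E) (i₀ : Fin n) (e : E) :
    congestionLoad P e =
      congestionLoad (Function.update P i₀ ∅) e + if e ∈ P i₀ then 1 else 0 := by
  unfold congestionLoad
  rw [Finset.card_filter, Finset.card_filter, ← Finset.add_sum_erase _ _ (Finset.mem_univ i₀),
    ← Finset.add_sum_erase _ (fun i => if e ∈ Function.update P i₀ ∅ i then 1 else 0)
      (Finset.mem_univ i₀)]
  have h : ∑ i ∈ Finset.univ.erase i₀, (if e ∈ Function.update P i₀ ∅ i then 1 else 0) =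
      ∑ i ∈ Finset.univ.erase i₀, (if e ∈ P i then 1 else 0) := by
    refine Finset.sum_congr rfl fun i hi => ?_
    rw [Function.update_of_ne (Finset.ne_of_mem_erase hi)]
  rw [h]
  simp [add_comm]

/-- The potential splits as the cost of `i₀` plus the potential without `i₀`. -/
theorem rosenthalPotential_eq_remove {E : Type*} [Fintype E] [DecidableEq E] {n : ℕ}
    (c : E → ℕ → ℝ) (P : Fin n → Finset E) (i₀ : Fin n) :
    rosenthalPotential c P = (∑ e ∈ P i₀, c e (congestionLoad P e)) +
      rosenthalPotential c (Function.update P i₀ ∅) := by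
  unfold rosenthalPotential
  have h : ∑ e ∈ P i₀, c e (congestionLoad P e) =
      ∑ e : E, if e ∈ P i₀ then c e (congestionLoad P e) else 0 := by
    simp
  rw [h, ← Finset.sum_add_distrib]
  refine Finset.sum_congr rfl fun e _ => ?_
  rw [congestionLoad_eq_remove P i₀ e]
  by_cases he : e ∈ P i₀
  · simp only [he, if_true]
    rw [Finset.sum_Icc_succ_top (by omega), add_comm]
  · simp [he]

/-- **Rosenthal's potential identity.** When player `i₀` deviates from `P i₀` to `Q`,
the change in her cost equals the change in the potential:
`Σ_{e ∈ P i₀} c(e, ℓ_P(e)) − Σ_{e ∈ Q} c(e, ℓ_{P'}(e)) = Ψ(P) − Ψ(P')`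
where `P' = Function.update P i₀ Q`. -/
theorem rosenthal_potential_deviation_identity
    {E : Type*} [Fintype E] [DecidableEq E] {n : ℕ}
    (c : E → ℕ → ℝ) (P : Fin n → Finset E) (i₀ : Fin n) (Q : Finset E) :
    (∑ e ∈ P i₀, c e (congestionLoad P e)) -
      (∑ e ∈ Q, c e (congestionLoad (Function.update P i₀ Q) e)) =
      rosenthalPotential c P - rosenthalPotential c (Function.update P i₀ Q) := by
  rw [rosenthalPotential_eq_remove c P i₀,
    rosenthalPotential_eq_remove c (Function.update P i₀ Q) i₀]
  simp only [Function.update_idem, Function.update_self]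
  ring
end

section
/- Let P : Fin n → Finset E be a profile with P(i) ∈ 𝒜ᵢ, let ℓ_P : E → ℕ be its loads, and let g : E → ℝ satisfy |g(e) − ℓ_P(e)| ≤ r for every edge e. Suppose player i's path is an η-best response with respect to the counts g, i.e. c_{P(i)}(g) ≤ c_Q(g) + η for every Q ∈ 𝒜ᵢ. Then for every Q ∈ 𝒜ᵢ, letting P' = Function.update P i Q, one has c_{P(i)}(ℓ_P) ≤ c_Q(ℓ_{P'}) + η + 2·λ·m·r + λ·m; i.e., player i's path is an (η + 2λmr + λm)-best response with respect to the true loads. (The paper states the constant η + λmr + λm; the bound here is the one its proof establishes, with the triangle inequality applied to both the player's own path and the deviation path.) -/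
theorem congestionLoad_update_close {E : Type*} [Fintype E] [DecidableEq E] {n : ℕ}
    (P : Fin n → Finset E) (i : Fin n) (Q : Finset E) (e : E) :
    |(congestionLoad P e : ℝ) - (congestionLoad (Function.update P i Q) e : ℝ)| ≤ 1 := by
  have key : ∀ P P' : Fin n → Finset E, (∀ j, j ≠ i → P j = P' j) →
      congestionLoad P e ≤ congestionLoad P' e + 1 := by
    intro P P' h
    unfold congestionLoad
    refine le_trans (Finset.card_le_card (t := insert i (Finset.univ.filter fun j => e ∈ P' j)) ?_)
      (Finset.card_insert_le _ _)
    intro j hj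
    by_cases hji : j = i
    · simp [hji]
    · have := h j hji
      simp_all
  have h1 := key P (Function.update P i Q) (fun j hj => by simp [hj])
  have h2 := key (Function.update P i Q) P (fun j hj => by simp [hj])
  have h1' : (congestionLoad P e : ℝ) ≤ congestionLoad (Function.update P i Q) e + 1 := by
    exact_mod_cast h1
  have h2' : (congestionLoad (Function.update P i Q) e : ℝ) ≤ congestionLoad P e + 1 := by
    exact_mod_cast h2
  rw [abs_le]
  constructor <;> linarith

theorem sum_cost_close {E : Type*} [Fintype E]
    (lam : ℝ) (hlam : 0 ≤ lam) (d : ℝ) (hd : 0 ≤ d)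
    (c : E → ℝ → ℝ) (hc : ∀ e : E, LipschitzWith lam.toNNReal (c e))
    (x y : E → ℝ) (hxy : ∀ e, |x e - y e| ≤ d) (S : Finset E) :
    ∑ e ∈ S, c e (x e) ≤ ∑ e ∈ S, c e (y e) + lam * (Fintype.card E : ℝ) * d := by
  have h : ∀ e ∈ S, c e (x e) ≤ c e (y e) + lam * d := by
    intro e _
    have h1 := (hc e).dist_le_mul (x e) (y e)
    rw [Real.dist_eq, Real.dist_eq, Real.coe_toNNReal _ hlam] at h1
    have h2 := mul_le_mul_of_nonneg_left (hxy e) hlam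
    have h3 := le_abs_self (c e (x e) - c e (y e))
    linarith
  have h4 := Finset.sum_le_sum h
  rw [Finset.sum_add_distrib, Finset.sum_const, nsmul_eq_mul] at h4
  have h5 : (S.card : ℝ) ≤ Fintype.card E := by exact_mod_cast Finset.card_le_univ S
  have h6 := mul_le_mul_of_nonneg_right h5 (mul_nonneg hlam hd)
  linarith

/-- **Best responses w.r.t. approximate counts are approximate best responses w.r.t. true
loads.** If `|g(e) − ℓ_P(e)| ≤ r` for all edges, each edge cost `c e` is `λ`-Lipschitz, and
player `i`'s path `P i` is an `η`-best response w.r.t. the counts `g`, then for every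
deviation `Q ∈ 𝒜 i`, with `P' = Function.update P i Q`,
`c_{P i}(ℓ_P) ≤ c_Q(ℓ_{P'}) + η + 2λmr + λm`, where `m = |E|`. -/
theorem approx_best_response_translate
    {E : Type*} [Fintype E] [DecidableEq E] {n : ℕ}
    (lam r η : ℝ) (hlam : 0 ≤ lam) (hr : 0 ≤ r) (hη : 0 ≤ η)
    (c : E → ℝ → ℝ) (hc : ∀ e : E, LipschitzWith lam.toNNReal (c e))
    (𝒜 : Fin n → Set (Finset E))
    (P : Fin n → Finset E) (hP : ∀ i, P i ∈ 𝒜 i)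
    (g : E → ℝ) (hg : ∀ e : E, |g e - (congestionLoad P e : ℝ)| ≤ r)
    (i : Fin n)
    (hbr : ∀ Q ∈ 𝒜 i, ∑ e ∈ P i, c e (g e) ≤ (∑ e ∈ Q, c e (g e)) + η) :
    ∀ Q ∈ 𝒜 i,
      ∑ e ∈ P i, c e ((congestionLoad P e : ℝ)) ≤
        (∑ e ∈ Q, c e ((congestionLoad (Function.update P i Q) e : ℝ))) + η +
          2 * lam * (Fintype.card E : ℝ) * r + lam * (Fintype.card E : ℝ) := by
  intro Q hQ
  have h1 := sum_cost_close lam hlam r hr c hc (fun e => (congestionLoad P e : ℝ)) g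
    (fun e => by rw [abs_sub_comm]; exact hg e) (P i)
  have h2 := hbr Q hQ
  have h3 := sum_cost_close lam hlam (r + 1) (by linarith) c hc g
    (fun e => (congestionLoad (Function.update P i Q) e : ℝ))
    (fun e => (abs_sub_le _ (congestionLoad P e : ℝ) _).trans
      (add_le_add (hg e) (congestionLoad_update_close P i Q e))) Q
  linarith
end
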